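/- For every real number x, one has x·arctan(x) ≥ (π/4)·√(1+x²) − π/2. -/

import Mathlib

/-- Pointwise inequality: `x·arctan(x) ≥ (π/4)·√(1+x²) − π/2` for every real `x`. -/
theorem stmt_3 (x : ℝ) :
    x * Real.arctan x ≥ Real.pi / 4 * Real.sqrt (1 + x ^ 2) - Real.pi / 2 := by
  wlog hx : 0 ≤ x generalizing x
  · simpa using this (-x) (by linarith)
  have hpi := Real.pi_pos
  have hsqrt : Real.sqrt (1 + x ^ 2) ≤ 1 + x :=
    Real.sqrt_le_iff.mpr ⟨by linarith, by nlinarith⟩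
  have harctan : Real.pi / 4 * (x - 1) ≤ x * Real.arctan x := by
    rcases le_total x 1 with h | h
    · have := mul_nonneg hx (Real.arctan_nonneg.mpr hx)
      nlinarith
    · have := Real.arctan_mono h
      rw [Real.arctan_one] at this
      nlinarith
  nlinarith
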